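/- arXiv:2504.08667 — 3 statements merged into one kernel-verified Lean document; each statement's English description precedes it below -/
import Mathlib

section
/- Let G = (V, E, s) be a graph in which every node is reachable from s and with |V| ≥ 2, and let k be the maximum size of a strongly connected component of G (an equivalence class of the mutual-reachability relation on V). Then the nesting width of G satisfies nw(G) ≤ 1 + k. -/
open Relation

variable {V : Type*}

/-- `p` is a path from `a` to `b` in the arc relation `E`:
a nonempty list of nodes starting at `a`, ending at `b`,
in which every consecutive pair of nodes is an arc. -/
def IsPath (E : V → V → Prop) (a b : V) (p : List V) : Prop :=
  p ≠ [] ∧ p.head? = some a ∧ p.getLast? = some b ∧ p.Chain' E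

/-- `a` dominates `b` (written `a ≥_s b`): every path from `s` to `b` contains `a`. -/
def Dom (E : V → V → Prop) (s a b : V) : Prop :=
  ∀ p : List V, IsPath E s b p → a ∈ p

/-- `m` is a source of module `M`: `m ∈ M`, every arc entering `M` from outside goes
to `m`, and (convention) if `s ∈ M` then `m = s`. -/
def ModuleSource (E : V → V → Prop) (s : V) (M : Set V) (m : V) : Prop :=
  m ∈ M ∧ (∀ u v, E u v → u ∉ M → v ∈ M → v = m) ∧ (s ∈ M → m = s)

/-- `M` is a module of the graph `(V, E, s)`. -/
def IsModule (E : V → V → Prop) (s : V) (M : Set V) : Prop :=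
  ∃ m, ModuleSource E s M m

/-- Two sets overlap: they intersect but neither contains the other. -/
def Overlap (M H : Set V) : Prop :=
  (M ∩ H).Nonempty ∧ ¬ M ⊆ H ∧ ¬ H ⊆ M

/-- A nesting decomposition: a collection of pairwise non-overlapping modules
containing the trivial modules (the whole node set and all singletons). -/
def IsNestingDecomp (E : V → V → Prop) (s : V) (F : Set (Set V)) : Prop :=
  (∀ M ∈ F, IsModule E s M) ∧
  (∀ M ∈ F, ∀ H ∈ F, ¬ Overlap M H) ∧
  (Set.univ : Set V) ∈ F ∧
  (∀ v : V, ({v} : Set V) ∈ F)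

/-- The maximal module partition of `M` within the family `F`. -/
def MaxPartition (F : Set (Set V)) (M : Set V) : Set (Set V) :=
  {H | H ∈ F ∧ H ⊂ M ∧ ¬ ∃ K ∈ F, H ⊂ K ∧ K ⊂ M}

/-- The width of a nesting decomposition `F`. -/
noncomputable def NDWidth (F : Set (Set V)) : ℕ :=
  ⨆ M ∈ F, (MaxPartition F M).ncard

/-- The nesting width of the graph `(V, E, s)`. -/
noncomputable def nestingWidth (E : V → V → Prop) (s : V) : ℕ :=
  sInf {w : ℕ | ∃ F : Set (Set V), IsNestingDecomp E s F ∧ NDWidth F = w}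

/-- `D(a)`: the set of nodes dominated by `a`. -/
def DomSet (E : V → V → Prop) (s a : V) : Set V := {v | Dom E s a v}

/-- `v` is a child of `a` in the dominator tree. -/
def IsChild (E : V → V → Prop) (s a v : V) : Prop :=
  v ≠ a ∧ Dom E s a v ∧ ∀ b, b ≠ a → b ≠ v → ¬(Dom E s a b ∧ Dom E s b v)

/-- `C(a)`: the set of children of `a` in the dominator tree. -/
def Children (E : V → V → Prop) (s a : V) : Set V := {v | IsChild E s a v}

/-- The arc relation of the graph `G_a` on the children of `a`. -/
def GArc (E : V → V → Prop) (s a : V) (u v : V) : Prop :=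
  u ∈ Children E s a ∧ v ∈ Children E s a ∧ u ≠ v ∧
    ∃ x y, E x y ∧ x ∈ DomSet E s u ∧ y ∈ DomSet E s v

/-- `S` is a strongly connected component of `G_a`
(an equivalence class of mutual reachability in `G_a`). -/
def IsSCC (E : V → V → Prop) (s a : V) (S : Set V) : Prop :=
  ∃ u ∈ Children E s a,
    S = {v | v ∈ Children E s a ∧ ReflTransGen (GArc E s a) u v ∧
          ReflTransGen (GArc E s a) v u}

/-- `L` lists the strongly connected components of `G_a` in topological order:
each member is an SCC of `G_a`, every child of `a` lies in exactly one listed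
component, and every arc of `G_a` goes from an earlier component to the same
or a later component. -/
def IsTopoSCCList (E : V → V → Prop) (s a : V) (L : List (Set V)) : Prop :=
  (∀ S ∈ L, IsSCC E s a S) ∧
  (∀ v ∈ Children E s a, ∃! i : Fin L.length, v ∈ L.get i) ∧
  (∀ i j : Fin L.length, ∀ u ∈ L.get i, ∀ v ∈ L.get j, GArc E s a u v → i ≤ j)

/-- `D(S) = ⋃_{v ∈ S} D(v)`. -/
def DSet (E : V → V → Prop) (s : V) (S : Set V) : Set V := ⋃ v ∈ S, DomSet E s v

/-- The set `{a} ∪ ⋃_{i=1}^{j} D(S^a_i)` (components indexed from 0 in the list). -/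
def PrefixModule (E : V → V → Prop) (s a : V) (L : List (Set V)) (j : ℕ) : Set V :=
  {a} ∪ ⋃ i ∈ Finset.range j, DSet E s (L.getD i ∅)

/-- The A-C family determined by a choice `L` of topologically ordered SCC lists. -/
def ACFamily (E : V → V → Prop) (s : V) (L : V → List (Set V)) : Set (Set V) :=
  {M | ∃ (a : V) (j : ℕ), j ≤ (L a).length ∧ M = PrefixModule E s a (L a) j}

/-- The quantity `max { |S^a_i| : a ∈ V, 1 ≤ i ≤ k_a }`. -/
noncomputable def MaxSCCSize (L : V → List (Set V)) : ℕ :=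
  ⨆ a : V, ⨆ i ∈ Finset.range (L a).length, ((L a).getD i ∅).ncard

theorem IsPath.reflTransGen {E : V → V → Prop} {a b : V} {p : List V}
    (hp : IsPath E a b p) : ReflTransGen E a b := by
  induction p generalizing a with
  | nil => exact absurd rfl hp.1
  | cons x l ih =>
    obtain ⟨-, hhead, hlast, hchain⟩ := hp
    obtain rfl : x = a := by simpa using hhead
    cases l with
    | nil =>
      obtain rfl : x = b := by simpa using hlast
      exact .refl
    | cons y l =>
      have hchain' := List.isChain_cons_cons.mp hchain
      exact .head hchain'.1 (ih ⟨by simp, by simp, by simpa using hlast, hchain'.2⟩)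

/-- Every node of a module that is reachable from `s` is reachable from the module's source. -/
theorem ModuleSource.reflTransGen {E : V → V → Prop} {s m x : V} {M : Set V}
    (hm : ModuleSource E s M m) (hx : x ∈ M) (hsx : ReflTransGen E s x) :
    ReflTransGen E m x := by
  induction hsx with
  | refl => rw [hm.2.2 hx]
  | @tail y z _ hyz ih =>
    by_cases hy : y ∈ M
    · exact (ih hy).tail hyz
    · rw [hm.2.1 y z hyz hy hx]

theorem IsModule.nonempty {E : V → V → Prop} {s : V} {M : Set V} (h : IsModule E s M) :
    M.Nonempty :=
  h.imp fun _ hm => hm.1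

theorem isNestingDecomp_trivial (E : V → V → Prop) (s : V) :
    IsNestingDecomp E s (insert Set.univ (Set.range fun v : V => ({v} : Set V))) := by
  refine ⟨?_, ?_, by simp, fun v => by simp⟩
  · rintro M (rfl | ⟨v, rfl⟩)
    · exact ⟨s, by simp [ModuleSource]⟩
    · exact ⟨v, by simp +contextual [ModuleSource, eq_comm]⟩
  · rintro M (rfl | ⟨v, rfl⟩) H (rfl | ⟨w, rfl⟩) <;> simp +contextual [Overlap, Set.Nonempty]

theorem Overlap.symm {M H : Set V} (h : Overlap M H) : Overlap H M :=
  ⟨Set.inter_comm M H ▸ h.1, h.2.2, h.2.1⟩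

theorem IsNestingDecomp.insert {E : V → V → Prop} {s : V} {F : Set (Set V)}
    (hF : IsNestingDecomp E s F) {U : Set V} (hU : IsModule E s U)
    (hUF : ∀ H ∈ F, ¬ Overlap U H) : IsNestingDecomp E s (insert U F) := by
  refine ⟨?_, ?_, .inr hF.2.2.1, fun v => .inr (hF.2.2.2 v)⟩
  · rintro M (rfl | hM)
    exacts [hU, hF.1 M hM]
  · rintro M (rfl | hM) H (rfl | hH)
    · exact fun h => h.2.1 subset_rfl
    · exact hUF H hH
    · exact fun h => hUF M hM h.symm
    · exact hF.2.1 M hM H hH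

section MaxPartition

variable {E : V → V → Prop} {s : V} {F : Set (Set V)} {M : Set V}

theorem IsNestingDecomp.eq_of_mem_maxPartition (hF : IsNestingDecomp E s F) {K L : Set V}
    (hK : K ∈ MaxPartition F M) (hL : L ∈ MaxPartition F M) {x : V} (hxK : x ∈ K)
    (hxL : x ∈ L) : K = L := by
  by_contra hne
  refine hF.2.1 K hK.1 L hL.1 ⟨⟨x, hxK, hxL⟩, fun h => ?_, fun h => ?_⟩
  · exact hK.2.2 ⟨L, hL.1, h.ssubset_of_ne hne, hL.2.1⟩
  · exact hL.2.2 ⟨K, hK.1, h.ssubset_of_ne (Ne.symm hne), hK.2.1⟩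

theorem exists_subset_mem_maxPartition [Finite V] {H : Set V} (hH : H ∈ F) (hHM : H ⊂ M) :
    ∃ K ∈ MaxPartition F M, H ⊆ K := by
  obtain ⟨K, hHK, hK⟩ :=
    (Set.toFinite {K : Set V | K ∈ F ∧ K ⊂ M}).exists_le_maximal ⟨hH, hHM⟩
  refine ⟨K, ⟨hK.prop.1, hK.prop.2, ?_⟩, hHK⟩
  rintro ⟨L, hL, hKL, hLM⟩
  exact hKL.2 (hK.2 ⟨hL, hLM⟩ hKL.1)

/-- A union of blocks of the maximal module partition of `M` overlaps no member of `F`. -/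
theorem IsNestingDecomp.not_overlap_sUnion [Finite V] (hF : IsNestingDecomp E s F)
    (hM : M ∈ F) {A : Set (Set V)} (hA : A ⊆ MaxPartition F M) {H : Set V} (hH : H ∈ F) :
    ¬ Overlap (⋃₀ A) H := by
  rintro ⟨⟨x, hxA, hxH⟩, hAH, hHA⟩
  have hAM : ⋃₀ A ⊆ M := Set.sUnion_subset fun K hK => (hA hK).2.1.1
  have hMH : ¬ M ⊆ H := fun h => hAH (hAM.trans h)
  have hHM : H ⊆ M := by
    by_contra h
    exact hF.2.1 M hM H hH ⟨⟨x, hAM hxA, hxH⟩, hMH, h⟩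
  obtain ⟨K, hK, hHK⟩ := exists_subset_mem_maxPartition hH ⟨hHM, hMH⟩
  obtain ⟨L, hL, hxL⟩ := hxA
  obtain rfl := hF.eq_of_mem_maxPartition hK (hA hL) (hHK hxH) hxL
  exact hHA (hHK.trans (Set.subset_sUnion_of_mem hL))

/-- The arc relation of the quotient of `M` by its maximal module partition, with the block
`B` removed. -/
def BlockArc (E : V → V → Prop) (F : Set (Set V)) (M B K L : Set V) : Prop :=
  (K ∈ MaxPartition F M ∧ K ≠ B) ∧ (L ∈ MaxPartition F M ∧ L ≠ B) ∧ ∃ x ∈ K, ∃ y ∈ L, E x y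

/-- The block containing the source of `M` together with all blocks that can reach `H` while
avoiding that block form a module. -/
theorem IsNestingDecomp.isModule_sUnion_blockArc [Finite V] (hF : IsNestingDecomp E s F)
    {m : V} (hm : ModuleSource E s M m) {B H : Set V} (hB : B ∈ MaxPartition F M)
    (hmB : m ∈ B) :
    IsModule E s (⋃₀ {K | K ∈ MaxPartition F M ∧
      (K = B ∨ ReflTransGen (BlockArc E F M B) K H)}) := by
  obtain ⟨b, hb⟩ := hF.1 B hB.1
  refine ⟨b, ⟨B, ⟨hB, .inl rfl⟩, hb.1⟩, ?_, ?_⟩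
  · rintro u v huv hu ⟨L, ⟨hL, hLH⟩, hvL⟩
    have huB : u ∉ B := fun h => hu ⟨B, ⟨hB, .inl rfl⟩, h⟩
    by_cases hLB : L = B
    · exact hb.2.1 u v huv huB (hLB ▸ hvL)
    replace hLH := hLH.resolve_left hLB
    by_cases huM : u ∈ M
    · have huM' : ({u} : Set V) ⊂ M := by
        refine ⟨by simpa using huM, fun h => ?_⟩
        obtain rfl : m = u := h hm.1
        exact huB hmB
      obtain ⟨K, hK, huK⟩ := exists_subset_mem_maxPartition (hF.2.2.2 u) huM'
      replace huK : u ∈ K := by simpa using huK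
      have hKB : K ≠ B := fun h => huB (h ▸ huK)
      exact absurd ⟨K, ⟨hK, .inr (hLH.head ⟨⟨hK, hKB⟩, ⟨hL, hLB⟩, u, huK, v, hvL, huv⟩)⟩, huK⟩ hu
    · obtain rfl := hm.2.1 u v huv huM (hL.2.1.1 hvL)
      exact absurd (hF.eq_of_mem_maxPartition hL hB hvL hmB) hLB
  · rintro ⟨K, ⟨hK, -⟩, hsK⟩
    exact hb.2.2 (hm.2.2 (hK.2.1.1 hsK) ▸ hmB)

/-- In an inclusion-maximal nesting decomposition, any two blocks of the maximal module
partition of `M` other than the one containing the source of `M` are mutually reachable. -/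
theorem IsNestingDecomp.reflTransGen_blockArc [Finite V]
    (hF : Maximal (IsNestingDecomp E s) F) (hM : M ∈ F) {m : V} (hm : ModuleSource E s M m)
    {B K H : Set V} (hB : B ∈ MaxPartition F M) (hmB : m ∈ B) (hK : K ∈ MaxPartition F M)
    (hKB : K ≠ B) (hH : H ∈ MaxPartition F M) (hHB : H ≠ B) :
    ReflTransGen (BlockArc E F M B) K H := by
  set A : Set (Set V) :=
    {K | K ∈ MaxPartition F M ∧ (K = B ∨ ReflTransGen (BlockArc E F M B) K H)}
  have hAP : A ⊆ MaxPartition F M := fun _ h => h.1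
  have hUF : ⋃₀ A ∈ F :=
    hF.2 (hF.prop.insert (hF.prop.isModule_sUnion_blockArc hm hB hmB)
      fun _ => hF.prop.not_overlap_sUnion hM hAP) (Set.subset_insert _ _) (Set.mem_insert _ _)
  have hBU : B ⊂ ⋃₀ A := by
    refine ⟨Set.subset_sUnion_of_mem ⟨hB, .inl rfl⟩, fun h => ?_⟩
    obtain ⟨x, hx⟩ := (hF.prop.1 H hH.1).nonempty
    exact hHB (hF.prop.eq_of_mem_maxPartition hH hB hx (h ⟨H, ⟨hH, .inr .refl⟩, hx⟩))
  have hMU : M ⊆ ⋃₀ A := by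
    by_contra h
    exact hB.2.2 ⟨_, hUF, hBU, Set.sUnion_subset fun K hK => hK.1.2.1.1, h⟩
  obtain ⟨x, hx⟩ := (hF.prop.1 K hK.1).nonempty
  obtain ⟨L, ⟨hL, hLH⟩, hxL⟩ := hMU (hK.2.1.1 hx)
  obtain rfl := hF.prop.eq_of_mem_maxPartition hK hL hx hxL
  exact hLH.resolve_left hKB

/-- Reachability between blocks yields reachability between their sources. -/
theorem IsNestingDecomp.reflTransGen_source (hF : IsNestingDecomp E s F)
    (hreach : ∀ v, ReflTransGen E s v) {B K L : Set V} {f : Set V → V}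
    (hf : ∀ H ∈ F, ModuleSource E s H (f H)) (hKL : ReflTransGen (BlockArc E F M B) K L) :
    ReflTransGen E (f K) (f L) := by
  induction hKL with
  | refl => exact .refl
  | @tail L L' _ hLL' ih =>
    obtain ⟨⟨hL, -⟩, ⟨hL', -⟩, x, hx, y, hy, hxy⟩ := hLL'
    by_cases hxL' : x ∈ L'
    · rwa [← hF.eq_of_mem_maxPartition hL hL' hx hxL']
    · rw [← (hf L' hL'.1).2.1 x y hxy hxL' hy]
      exact (ih.trans ((hf L hL.1).reflTransGen hx (hreach x))).tail hxy

theorem IsNestingDecomp.ncard_maxPartition_le [Finite V]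
    (hF : Maximal (IsNestingDecomp E s) F) (hreach : ∀ v, ReflTransGen E s v) {k : ℕ}
    (hk : ∀ v : V, {u : V | ReflTransGen E v u ∧ ReflTransGen E u v}.ncard ≤ k)
    (hM : M ∈ F) : (MaxPartition F M).ncard ≤ 1 + k := by
  have hsrc : ∀ H : Set V, ∃ m, H ∈ F → ModuleSource E s H m := fun H => by
    by_cases hH : H ∈ F
    · exact (hF.prop.1 H hH).imp fun _ h _ => h
    · exact ⟨s, fun h => absurd h hH⟩
  choose f hf using hsrc
  have hm := hf M hM
  rcases (MaxPartition F M).eq_empty_or_nonempty with hP | ⟨K, hK⟩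
  · simp [hP]
  have hmM : ({f M} : Set V) ⊂ M := by
    refine ⟨by simpa using hm.1, fun h => ?_⟩
    rcases Set.subset_singleton_iff_eq.mp (hK.2.1.1.trans h) with rfl | rfl
    · exact (hF.prop.1 ∅ hK.1).nonempty.ne_empty rfl
    · exact hK.2.1.2 h
  obtain ⟨B, hB, hmB⟩ := exists_subset_mem_maxPartition (hF.prop.2.2.2 (f M)) hmM
  replace hmB : f M ∈ B := by simpa using hmB
  suffices (MaxPartition F M \ {B}).ncard ≤ k by
    have := Set.ncard_sdiff_singleton_add_one hB (Set.toFinite _)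
    omega
  rcases (MaxPartition F M \ {B}).eq_empty_or_nonempty with hP | ⟨H, hH, hHB⟩
  · simp [hP]
  refine le_trans (Set.ncard_le_ncard_of_injOn f ?_ ?_ (Set.toFinite _)) (hk (f H))
  · rintro L ⟨hL, hLB⟩
    exact ⟨hF.prop.reflTransGen_source hreach hf
        (reflTransGen_blockArc hF hM hm hB hmB hH hHB hL hLB),
      hF.prop.reflTransGen_source hreach hf
        (reflTransGen_blockArc hF hM hm hB hmB hL hLB hH hHB)⟩
  · rintro L ⟨hL, -⟩ L' ⟨hL', -⟩ h
    exact hF.prop.eq_of_mem_maxPartition hL hL' (hf L hL.1).1 (h ▸ (hf L' hL'.1).1)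

end MaxPartition

/-- if `k` is the maximum size of a strongly connected component of
`G` (an equivalence class of mutual reachability), then `nw(G) ≤ 1 + k`. -/
theorem nestingWidth_le_scc [Fintype V] (E : V → V → Prop) (s : V)
    (hreach : ∀ v : V, ∃ p : List V, IsPath E s v p)
    (hcard : 2 ≤ Fintype.card V)
    (k : ℕ)
    (hk : k = ⨆ v : V,
      {u : V | Relation.ReflTransGen E v u ∧ Relation.ReflTransGen E u v}.ncard) :
    nestingWidth E s ≤ 1 + k := by
  obtain ⟨F, -, hF⟩ :=
    (Set.toFinite {F | IsNestingDecomp E s F}).exists_le_maximal (isNestingDecomp_trivial E s)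
  have hk' (v : V) : {u : V | ReflTransGen E v u ∧ ReflTransGen E u v}.ncard ≤ k :=
    hk ▸ le_ciSup (f := fun v : V => {u : V | ReflTransGen E v u ∧ ReflTransGen E u v}.ncard)
      (Set.finite_range _).bddAbove v
  have hreach' (v : V) : ReflTransGen E s v := (hreach v).elim fun _ hp => hp.reflTransGen
  have hw : nestingWidth E s ≤ NDWidth F := Nat.sInf_le ⟨F, hF.prop, rfl⟩
  refine hw.trans ?_
  exact ciSup_le' fun M => ciSup_le' fun hM =>
    IsNestingDecomp.ncard_maxPartition_le hF hreach' hk' hM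
end

section
/- Let G = (V, E, s) be a graph in which every node is reachable from s. Let α ∈ V and let S ⊆ C(α) be a set of children of α with |S| ≥ 2 that is strongly connected in G_α. Let M be a module of G with s ∉ M such that M ∩ S ≠ ∅ and S ⊄ M. Then the source of M is an element v ∈ S ∩ M, and M ⊆ D(v). -/
open Relation

variable {V : Type*}

/-- A path can be extended by an arc at its end. -/
theorem IsPath.append_singleton {E : V → V → Prop} {a x y : V} {p : List V}
    (hp : IsPath E a x p) (hxy : E x y) : IsPath E a y (p ++ [y]) := by
  obtain ⟨hne, hhead, hlast, hchain⟩ := hp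
  refine ⟨by simp, ?_, by simp, ?_⟩
  · rw [List.head?_append_of_ne_nil _ hne, hhead]
  · refine List.IsChain.append hchain (List.isChain_singleton y) ?_
    intro u hu v hv
    simp_all

theorem Dom.refl (E : V → V → Prop) (s a : V) : Dom E s a a :=
  fun _ hp => List.mem_of_getLast? hp.2.2.1

theorem Dom.eq_source {E : V → V → Prop} {s a : V} (h : Dom E s a s) : a = s := by
  simpa using h [s] ⟨by simp, rfl, rfl, List.isChain_singleton s⟩

theorem Dom.eq_or_dom_of_arc {E : V → V → Prop} {s a x y : V} (h : Dom E s a y)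
    (hxy : E x y) : a = y ∨ Dom E s a x := by
  refine or_iff_not_imp_left.2 fun hay p hp => ?_
  simpa [hay] using h _ (hp.append_singleton hxy)

theorem Dom.trans {E : V → V → Prop} {s a b c : V} (hab : Dom E s a b)
    (hbc : Dom E s b c) : Dom E s a c := by
  intro p hp
  obtain ⟨l, r, rfl⟩ := List.append_of_mem (hbc p hp)
  obtain ⟨-, hhead, -, hchain⟩ := hp
  have hsplit : l ++ b :: r = (l ++ [b]) ++ r := by simp
  rw [hsplit] at hchain hhead ⊢
  refine List.mem_append_left _ (hab _ ⟨by simp, ?_, by simp, ?_⟩)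
  · rwa [List.head?_append_of_ne_nil _ (by simp)] at hhead
  · exact (List.isChain_append.1 hchain).1

/-- A set avoiding the source `s` that can only be entered at `a` is dominated by `a`. -/
theorem dom_of_entry {E : V → V → Prop} {s a b : V} {N : Set V} (hs : s ∉ N)
    (hN : ∀ x y, E x y → x ∉ N → y ∈ N → y = a) (hb : b ∈ N) : Dom E s a b := by
  intro p hp
  suffices H : ∀ (q : List V) (c : V), c ∉ N ∨ c = a → IsPath E c b q → a ∈ q from
    H p s (.inl hs) hp
  intro q
  induction q with
  | nil => exact fun c _ hq => absurd rfl hq.1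
  | cons d r ih =>
    rintro c hc ⟨-, hhead, hlast, hchain⟩
    obtain rfl : d = c := by simpa using hhead
    by_cases hda : d = a
    · simp [hda]
    have hdN : d ∉ N := hc.resolve_right hda
    cases r with
    | nil =>
      obtain rfl : d = b := by simpa using hlast
      exact absurd hb hdN
    | cons e r =>
      obtain ⟨hde, hr⟩ := List.isChain_cons_cons.1 hchain
      refine List.mem_cons_of_mem _ (ih e ?_ ⟨by simp, rfl, by simpa using hlast, hr⟩)
      exact or_iff_not_imp_left.2 fun he => hN d e hde hdN (not_not.1 he)

/-- The dominators of a reachable node form a chain. -/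
theorem Dom.total {E : V → V → Prop} {s a b w : V} (hw : ReflTransGen E s w)
    (ha : Dom E s a w) (hb : Dom E s b w) : Dom E s a b ∨ Dom E s b a := by
  induction hw with
  | refl =>
    rw [ha.eq_source, hb.eq_source]
    exact .inl (Dom.refl E s s)
  | tail _ hxy ih =>
    rcases ha.eq_or_dom_of_arc hxy with rfl | ha'
    · exact .inr hb
    rcases hb.eq_or_dom_of_arc hxy with rfl | hb'
    · exact .inl ha
    exact ih ha' hb'

theorem Dom.antisymm {E : V → V → Prop} {s a b : V} (hb : ReflTransGen E s b)
    (hab : Dom E s a b) (hba : Dom E s b a) : a = b := by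
  suffices H : ∀ w, ReflTransGen E s w → Dom E s a w → a = b from H b hb hab
  intro w hw
  induction hw with
  | refl => exact fun ha => ha.eq_source.trans (hba.trans ha).eq_source.symm
  | tail _ hxy ih =>
    intro ha
    rcases ha.eq_or_dom_of_arc hxy with rfl | ha'
    · rcases hba.eq_or_dom_of_arc hxy with h | hb'
      · exact h.symm
      · exact ih (hab.trans hb')
    · exact ih ha'

/-- A node outside `M` dominating some node of `M` dominates the only entry of `M`. -/
theorem Dom.dom_entry {E : V → V → Prop} {s m w x : V} {M : Set V} (hs : s ∉ M)
    (hM : ∀ u v, E u v → u ∉ M → v ∈ M → v = m) (hx : ReflTransGen E s x)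
    (hwx : Dom E s w x) (hxM : x ∈ M) (hwM : w ∉ M) : Dom E s w m := by
  induction hx with
  | refl => exact absurd hxM hs
  | @tail y z _ hyz ih =>
    by_cases hy : y ∈ M
    · rcases hwx.eq_or_dom_of_arc hyz with rfl | h
      · exact absurd hxM hwM
      · exact ih h hy
    · exact hM y z hyz hy hxM ▸ hwx

theorem IsChild.eq_of_dom {E : V → V → Prop} {s a u v : V} (hu : IsChild E s a u)
    (hv : IsChild E s a v) (huv : Dom E s u v) : u = v :=
  by_contra fun hne => hv.2.2 u hu.1 hne ⟨hu.2.1, huv⟩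

/-- An arc between the dominator subtrees of distinct siblings enters at the root. -/
theorem IsChild.eq_of_arc {E : V → V → Prop} {s a u v x y : V} (hx : ReflTransGen E s x)
    (hu : IsChild E s a u) (hv : IsChild E s a v) (huv : u ≠ v) (hxy : E x y)
    (hux : Dom E s u x) (hvy : Dom E s v y) : v = y := by
  refine (hvy.eq_or_dom_of_arc hxy).resolve_right fun hvx => huv ?_
  rcases hux.total hx hvx with h | h
  · exact hu.eq_of_dom hv h
  · exact (hv.eq_of_dom hu h).symm

/-- A chain of related elements entering `M` crosses its boundary. -/
theorem Relation.ReflTransGen.exists_entering {R : V → V → Prop} {u v : V} {M : Set V}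
    (h : ReflTransGen R u v) (hu : u ∉ M) (hv : v ∈ M) :
    ∃ x y, R x y ∧ x ∉ M ∧ y ∈ M := by
  induction h with
  | refl => exact absurd hv hu
  | @tail x y _ hxy ih =>
    by_cases hx : x ∈ M
    · exact ih hx
    · exact ⟨x, y, hxy, hx, hv⟩

/-- let `S ⊆ C(α)` with `|S| ≥ 2` be strongly connected in `G_α`,
and let `M` be a module with `s ∉ M`, `M ∩ S ≠ ∅` and `S ⊄ M`. Then the source of
`M` is an element of `S ∩ M` and `M ⊆ D(source)`. -/
theorem module_meeting_scc [Fintype V] (E : V → V → Prop) (s : V)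
    (hreach : ∀ v : V, ∃ p : List V, IsPath E s v p)
    (α : V) (S : Set V) (hS : S ⊆ Children E s α) (hScard : 2 ≤ S.ncard)
    (hsc : ∀ u ∈ S, ∀ v ∈ S, Relation.ReflTransGen (GArc E s α) u v)
    (M : Set V) (hM : IsModule E s M) (hsM : s ∉ M)
    (hne : (M ∩ S).Nonempty) (hnsub : ¬ S ⊆ M) :
    ∀ m : V, (m ∈ M ∧ ∀ u v, E u v → u ∉ M → v ∈ M → v = m) →
      m ∈ S ∩ M ∧ M ⊆ DomSet E s m := by
  rintro m ⟨hmM, hentry⟩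
  have hr : ∀ w, ReflTransGen E s w := fun w => (hreach w).choose_spec.reflTransGen
  have hdom : M ⊆ DomSet E s m := fun x hx => dom_of_entry hsM hentry hx
  refine ⟨⟨?_, hmM⟩, hdom⟩
  obtain ⟨v, hvM, hvS⟩ := hne
  obtain ⟨u, huS, huM⟩ := Set.not_subset.1 hnsub
  by_contra hmS
  have hmv : m ≠ v := fun h => hmS (h ▸ hvS)
  have hv : IsChild E s α v := hS hvS
  have hmα : Dom E s m α := by
    by_cases h : m = α
    · exact h ▸ Dom.refl E s m
    · exact ((hdom hvM).total (hr v) hv.2.1).resolve_right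
        fun h' => hv.2.2 m h hmv ⟨h', hdom hvM⟩
  obtain ⟨w₁, w₂, ⟨hw₁, hw₂, hw, x, y, hxy, hx, hy⟩, hw₁M, hw₂M⟩ :=
    (hsc u huS v hvS).exists_entering huM hvM
  obtain rfl := IsChild.eq_of_arc (hr x) hw₁ hw₂ hw hxy hx hy
  by_cases hxM : x ∈ M
  · have hw₁m : Dom E s w₁ m := Dom.dom_entry hsM hentry (hr x) hx hxM hw₁M
    exact hw₁.1 ((hw₁m.trans hmα).antisymm (hr α) hw₁.2.1)
  · obtain rfl := hentry x w₂ hxy hxM hw₂M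
    exact hw₂.1 (hmα.antisymm (hr α) hw₂.2.1)
end

section
/- Let G = (V, E, s) be a graph in which every node is reachable from s. Let α ∈ V and let S ⊆ C(α) be a set of children of α with |S| ≥ 2 that is strongly connected in G_α. If K is a module of G with S ⊆ K, then K is not a subset of D(S); that is, K contains at least one node outside ⋃_{v ∈ S} D(v). -/
open Relation

variable {V : Type*}

/-- A path ending in `M` that starts outside `M` or at the source of `M` visits the source. -/
theorem ModuleSource.mem_of_isPath {E : V → V → Prop} {s m b : V} {M : Set V}
    (hM : ModuleSource E s M m) (hb : b ∈ M) (p : List V) :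
    ∀ a : V, (a ∈ M → a = m) → IsPath E a b p → m ∈ p := by
  induction p with
  | nil => exact fun a _ hp => absurd rfl hp.1
  | cons x p ih =>
    rintro a ha ⟨-, hhead, hlast, hchain⟩
    obtain rfl : x = a := by simpa using hhead
    by_cases hx : x ∈ M
    · simp [ha hx]
    · cases p with
      | nil =>
        obtain rfl : x = b := by simpa using hlast
        exact absurd hb hx
      | cons y p =>
        obtain ⟨hxy, hchain⟩ := List.isChain_cons_cons.mp hchain
        exact List.mem_cons_of_mem x
          (ih y (hM.2.1 x y hxy hx) ⟨by simp, rfl, by simpa using hlast, hchain⟩)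

/-- The source of a module dominates every node of the module. -/
theorem ModuleSource.dom {E : V → V → Prop} {s m b : V} {M : Set V}
    (hM : ModuleSource E s M m) (hb : b ∈ M) : Dom E s m b :=
  fun p hp => hM.mem_of_isPath hb p s (fun hs => (hM.2.2 hs).symm) hp

/-- let `S ⊆ C(α)` with `|S| ≥ 2` be strongly connected in `G_α`.
Any module `K` containing `S` contains a node outside `D(S)`. -/
theorem module_containing_scc_exceeds [Fintype V] (E : V → V → Prop) (s : V)
    (hreach : ∀ v : V, ∃ p : List V, IsPath E s v p)
    (α : V) (S : Set V) (hS : S ⊆ Children E s α) (hScard : 2 ≤ S.ncard)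
    (hsc : ∀ u ∈ S, ∀ v ∈ S, Relation.ReflTransGen (GArc E s α) u v)
    (K : Set V) (hK : IsModule E s K) (hSK : S ⊆ K) :
    ¬ K ⊆ DSet E s S := by
  obtain ⟨m, hm⟩ := hK
  intro hKS
  obtain ⟨u, hu, hum⟩ := Set.mem_iUnion₂.mp (hKS hm.1)
  obtain ⟨v, hv, hvu⟩ := Set.exists_ne_of_one_lt_ncard (by omega : 1 < S.ncard) u
  obtain ⟨-, -, hmin⟩ := hS hv
  obtain ⟨huα, hαu, -⟩ := hS hu
  exact hmin u huα hvu.symm ⟨hαu, Dom.trans hum (hm.dom (hSK hv))⟩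
end
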